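/- arXiv:2005.11287 — 2 statements merged into one kernel-verified Lean document; each statement's English description precedes it below -/
import Mathlib

section
/- Let Ω ⊂ ℝ² be a triangle whose longest side has length L, and let u ∈ H₀¹(Ω) ∩ H^s(Ω) for all s ≥ 0. Then ‖u‖_{L²(Ω)} ≤ L√(e−1) ‖∂ₓu‖_{L²(Ω)}, where ∂ₓ denotes the partial derivative in the first coordinate direction. -/
open MeasureTheory
open scoped InnerProductSpace

noncomputable section

/-- Euclidean `n`-space. -/
abbrev En (n : ℕ) : Type := EuclideanSpace ℝ (Fin n)

/-- Partial derivative in the `j`-th coordinate direction. -/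
def pdv {n : ℕ} (j : Fin n) (f : En n → ℂ) (x : En n) : ℂ :=
  fderiv ℝ f x (EuclideanSpace.single j 1)

/-- A `C¹` function vanishing at the left endpoint of an interval of length at most `L` has `L²`
norm at most `L` times that of its derivative. -/
lemma setIntegral_norm_sq_le_of_left_eq_zero {f f' : ℝ → ℂ} {a b L : ℝ} (hab : a ≤ b)
    (hL : b - a ≤ L) (hf : ∀ x, HasDerivAt f (f' x) x) (hf' : Continuous f') (ha : f a = 0) :
    ∫ x in Set.Icc a b, ‖f x‖ ^ 2 ≤ L ^ 2 * ∫ x in Set.Icc a b, ‖f' x‖ ^ 2 := by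
  have hfc : Continuous f := continuous_iff_continuousAt.2 fun x => (hf x).continuousAt
  rw [integral_Icc_eq_integral_Ioc, integral_Icc_eq_integral_Ioc,
    ← intervalIntegral.integral_of_le hab, ← intervalIntegral.integral_of_le hab]
  have hint : ∀ g : ℝ → ℝ, Continuous g → IntervalIntegrable g volume a b :=
    fun g hg => hg.intervalIntegrable _ _
  set I := ∫ x in a..b, ‖f' x‖ with hI
  set J := ∫ x in a..b, ‖f' x‖ ^ 2 with hJ
  have hI0 : 0 ≤ I := intervalIntegral.integral_nonneg hab fun _ _ => norm_nonneg _
  have hJ0 : 0 ≤ J := intervalIntegral.integral_nonneg hab fun _ _ => by positivity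
  have hquad : ∀ t : ℝ, 0 ≤ J - 2 * t * I + t ^ 2 * (b - a) := by
    intro t
    have h0 : 0 ≤ ∫ x in a..b, (‖f' x‖ - t) ^ 2 :=
      intervalIntegral.integral_nonneg hab fun _ _ => sq_nonneg _
    have h1 : ∫ x in a..b, (‖f' x‖ - t) ^ 2
        = ∫ x in a..b, (‖f' x‖ ^ 2 - 2 * t * ‖f' x‖ + t ^ 2) := by
      congr 1; ext x; ring
    rw [h1, intervalIntegral.integral_add (hint _ (by fun_prop)) (hint _ (by fun_prop)),
      intervalIntegral.integral_sub (hint _ (by fun_prop)) (hint _ (by fun_prop)),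
      intervalIntegral.integral_const_mul, intervalIntegral.integral_const, smul_eq_mul] at h0
    linarith
  have hcs : I ^ 2 ≤ (b - a) * J := by
    rcases hab.eq_or_lt with rfl | hlt
    · simp [hI]
    · have hd : 0 < b - a := sub_pos.2 hlt
      have h := mul_nonneg hd.le (hquad (I / (b - a)))
      have h2 : (b - a) * (J - 2 * (I / (b - a)) * I + (I / (b - a)) ^ 2 * (b - a))
          = (b - a) * J - I ^ 2 := by
        field_simp; ring
      linarith
  have hpt : ∀ x ∈ Set.Icc a b, ‖f x‖ ^ 2 ≤ (b - a) * J := by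
    intro x hx
    have hftc : ∫ t in a..x, f' t = f x := by
      rw [intervalIntegral.integral_eq_sub_of_hasDerivAt (fun t _ => hf t)
        (hf'.intervalIntegrable _ _), ha, sub_zero]
    have h1 : ‖f x‖ ≤ I := by
      rw [← hftc]
      refine (intervalIntegral.norm_integral_le_integral_norm hx.1).trans ?_
      exact intervalIntegral.integral_mono_interval le_rfl hx.1 hx.2
        (Filter.Eventually.of_forall fun _ => norm_nonneg _) (hint _ (by fun_prop))
    exact (pow_le_pow_left₀ (norm_nonneg _) h1 2).trans hcs
  calc ∫ x in a..b, ‖f x‖ ^ 2 ≤ ∫ _ in a..b, (b - a) * J :=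
        intervalIntegral.integral_mono_on hab (hint _ (by fun_prop)) (hint _ (by fun_prop)) hpt
    _ = (b - a) ^ 2 * J := by
        rw [intervalIntegral.integral_const, smul_eq_mul]; ring
    _ ≤ L ^ 2 * J := by
        have : 0 ≤ b - a := sub_nonneg.2 hab
        gcongr

/-- The point of the Euclidean plane with the given coordinates. -/
def planePoint (p : ℝ × ℝ) : En 2 := !₂[p.1, p.2]

lemma planePoint_eq_add_smul (x y : ℝ) :
    planePoint (x, y) = planePoint (0, y) + x • EuclideanSpace.single (0 : Fin 2) (1 : ℝ) := by
  ext i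
  fin_cases i <;> simp [planePoint]

lemma continuous_planePoint : Continuous planePoint := by
  unfold planePoint
  fun_prop

lemma dist_planePoint (x x' y : ℝ) : dist (planePoint (x, y)) (planePoint (x', y)) = |x - x'| := by
  simp [planePoint, EuclideanSpace.dist_eq, Real.dist_eq, Real.sqrt_sq_eq_abs]

/-- `planePoint` as a measurable equivalence. -/
def planeEquiv : ℝ × ℝ ≃ᵐ En 2 :=
  (MeasurableEquiv.finTwoArrow (α := ℝ)).symm.trans (MeasurableEquiv.toLp 2 (Fin 2 → ℝ))

lemma coe_planeEquiv : ⇑planeEquiv = planePoint := rfl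

lemma measurePreserving_planePoint : MeasurePreserving planePoint := by
  rw [← coe_planeEquiv]
  exact (PiLp.volume_preserving_toLp (Fin 2)).comp
    ((volume_preserving_finTwoArrow ℝ).symm MeasurableEquiv.finTwoArrow)

lemma measurableEmbedding_planePoint : MeasurableEmbedding planePoint :=
  coe_planeEquiv ▸ planeEquiv.measurableEmbedding

lemma hasDerivAt_comp_planePoint {u : En 2 → ℂ} (hu : Differentiable ℝ u) (x y : ℝ) :
    HasDerivAt (fun t => u (planePoint (t, y))) (pdv 0 u (planePoint (x, y))) x := by
  have h : HasDerivAt (fun t => planePoint (t, y)) (EuclideanSpace.single (0 : Fin 2) (1 : ℝ)) x := by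
    rw [funext fun t => planePoint_eq_add_smul t y]
    simpa using ((hasDerivAt_id x).smul_const
      (EuclideanSpace.single (0 : Fin 2) (1 : ℝ))).const_add (planePoint (0, y))
  exact (hu _).hasFDerivAt.comp_hasDerivAt x h

lemma integrable_indicator_comp_planePoint {Ω : Set (En 2)} (hΩ : IsCompact Ω) {g : En 2 → ℝ}
    (hg : Continuous g) :
    Integrable (fun p : ℝ × ℝ => Ω.indicator g (planePoint p)) (volume.prod volume) := by
  have h : Integrable (Ω.indicator g) :=
    (integrable_indicator_iff hΩ.measurableSet).2 (hg.continuousOn.integrableOn_compact hΩ)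
  exact (measurePreserving_planePoint.integrable_comp_emb measurableEmbedding_planePoint).2 h

lemma setIntegral_eq_integral_slices {Ω : Set (En 2)} (hΩ : IsCompact Ω) {g : En 2 → ℝ}
    (hg : Continuous g) :
    ∫ z in Ω, g z = ∫ y, ∫ x, Ω.indicator g (planePoint (x, y)) := by
  rw [← integral_indicator hΩ.measurableSet,
    ← measurePreserving_planePoint.integral_comp measurableEmbedding_planePoint]
  exact integral_prod_symm _ (integrable_indicator_comp_planePoint hΩ hg)

lemma integral_slice_le {Ω : Set (En 2)} (hΩ : IsCompact Ω) (hconv : Convex ℝ Ω) {L : ℝ}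
    (hL : ∀ p ∈ Ω, ∀ r ∈ Ω, dist p r ≤ L) {u : En 2 → ℂ} (hu : ContDiff ℝ 1 u)
    (hpdv : Continuous (pdv 0 u)) (hu_bd : ∀ x ∈ frontier Ω, u x = 0) (y : ℝ) :
    ∫ x, Ω.indicator (fun z => ‖u z‖ ^ 2) (planePoint (x, y))
      ≤ L ^ 2 * ∫ x, Ω.indicator (fun z => ‖pdv 0 u z‖ ^ 2) (planePoint (x, y)) := by
  have hc : Continuous fun x : ℝ => planePoint (x, y) :=
    continuous_planePoint.comp (by fun_prop)
  set S : Set ℝ := (fun x : ℝ => planePoint (x, y)) ⁻¹' Ω with hS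
  have hSclosed : IsClosed S := hΩ.isClosed.preimage hc
  have hind : ∀ g : En 2 → ℝ,
      ∫ x, Ω.indicator g (planePoint (x, y)) = ∫ x in S, g (planePoint (x, y)) := fun g => by
    rw [← integral_indicator hSclosed.measurableSet]
    rfl
  rw [hind, hind]
  rcases S.eq_empty_or_nonempty with he | hne
  · simp [he]
  have hSconv : Convex ℝ S := by
    intro x hx x' hx' s t hs ht hst
    have h := hconv hx hx' hs ht hst
    have h2 : s • planePoint (x, y) + t • planePoint (x', y) = planePoint (s • x + t • x', y) := by
      ext i
      fin_cases i
      · simp [planePoint]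
      · simp [planePoint, ← add_mul, hst]
    exact (congrArg (· ∈ Ω) h2).mp h
  have hSdist : ∀ x ∈ S, ∀ x' ∈ S, dist x x' ≤ L := fun x hx x' hx' => by
    rw [Real.dist_eq, ← dist_planePoint x x' y]
    exact hL _ hx _ hx'
  have hScompact : IsCompact S :=
    Metric.isCompact_of_isClosed_isBounded hSclosed (Metric.isBounded_iff.2 ⟨L, hSdist⟩)
  have hIcc : S = Set.Icc (sInf S) (sSup S) :=
    eq_Icc_of_connected_compact ⟨hne, hSconv.isPreconnected⟩ hScompact
  have ha := hScompact.sInf_mem hne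
  have hb := hScompact.sSup_mem hne
  have hab : sInf S ≤ sSup S := le_csSup hScompact.bddAbove ha
  have hbd : planePoint (sInf S, y) ∈ frontier Ω := by
    refine ⟨subset_closure ha, fun hint => ?_⟩
    have h : sInf S ∈ interior S := preimage_interior_subset_interior_preimage hc hint
    rw [hIcc, interior_Icc] at h
    have h2 := h.1
    rw [← hIcc] at h2
    exact lt_irrefl _ h2
  rw [hIcc]
  refine setIntegral_norm_sq_le_of_left_eq_zero hab
    ((le_abs_self _).trans (hSdist _ hb _ ha))
    (fun x => hasDerivAt_comp_planePoint (hu.differentiable one_ne_zero) x y)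
    (hpdv.comp hc) (hu_bd _ hbd)

/-- Poincaré inequality in the first coordinate direction on a compact convex planar set. -/
lemma setIntegral_norm_sq_le_pdv {Ω : Set (En 2)} (hΩ : IsCompact Ω) (hconv : Convex ℝ Ω) {L : ℝ}
    (hL : ∀ p ∈ Ω, ∀ r ∈ Ω, dist p r ≤ L) {u : En 2 → ℂ} (hu : ContDiff ℝ 1 u)
    (hu_bd : ∀ x ∈ frontier Ω, u x = 0) :
    ∫ x in Ω, ‖u x‖ ^ 2 ≤ L ^ 2 * ∫ x in Ω, ‖pdv (0 : Fin 2) u x‖ ^ 2 := by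
  have hpdv : Continuous (pdv (0 : Fin 2) u) :=
    (hu.continuous_fderiv one_ne_zero).clm_apply continuous_const
  have hcu : Continuous fun z => ‖u z‖ ^ 2 := hu.continuous.norm.pow 2
  have hcp : Continuous fun z => ‖pdv (0 : Fin 2) u z‖ ^ 2 := hpdv.norm.pow 2
  rw [setIntegral_eq_integral_slices hΩ hcu, setIntegral_eq_integral_slices hΩ hcp,
    ← integral_const_mul]
  exact integral_mono (integrable_indicator_comp_planePoint hΩ hcu).integral_prod_right
    ((integrable_indicator_comp_planePoint hΩ hcp).integral_prod_right.const_mul _)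
    (integral_slice_le hΩ hconv hL hu hpdv hu_bd)

/-- **Poincaré-type inequality on a triangle.**
If `Ω ⊂ ℝ²` is a triangle whose longest side has length `L`, and `u` is smooth and
vanishes on `∂Ω` (so that `u ∈ H₀¹(Ω) ∩ H^s(Ω)` for all `s ≥ 0`), then
`‖u‖_{L²(Ω)} ≤ L √(e−1) ‖∂ₓ u‖_{L²(Ω)}`. -/
theorem poincare_type_inequality_triangle
    (q : Fin 3 → En 2) (hq : AffineIndependent ℝ q)
    (Ω : Set (En 2)) (hΩ : Ω = convexHull ℝ (Set.range q))
    (L : ℝ) (hL : L = max (dist (q 0) (q 1)) (max (dist (q 1) (q 2)) (dist (q 0) (q 2))))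
    (u : En 2 → ℂ) (hu : ContDiff ℝ (⊤ : ℕ∞) u)
    (hu_bd : ∀ x ∈ frontier Ω, u x = 0) :
    Real.sqrt (∫ x in Ω, ‖u x‖ ^ 2)
      ≤ L * Real.sqrt (Real.exp 1 - 1)
          * Real.sqrt (∫ x in Ω, ‖pdv (0 : Fin 2) u x‖ ^ 2) := by
  have hΩc : IsCompact Ω := hΩ ▸ (Set.finite_range q).isCompact_convexHull ℝ
  have hΩconv : Convex ℝ Ω := hΩ ▸ convex_convexHull ℝ _
  have hL0 : 0 ≤ L := hL ▸ dist_nonneg.trans (le_max_left _ _)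
  have hq_dist : ∀ i j, dist (q i) (q j) ≤ L := by
    intro i j
    have h01 : dist (q 0) (q 1) ≤ L := hL ▸ le_max_left _ _
    have h12 : dist (q 1) (q 2) ≤ L := hL ▸ (le_max_left _ _).trans (le_max_right _ _)
    have h02 : dist (q 0) (q 2) ≤ L := hL ▸ (le_max_right _ _).trans (le_max_right _ _)
    fin_cases i <;> fin_cases j <;>
      first
        | exact (dist_self _).trans_le hL0
        | assumption
        | exact (dist_comm _ _).trans_le (by assumption)
  have hdiam : ∀ p ∈ Ω, ∀ r ∈ Ω, dist p r ≤ L := by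
    intro p hp r hr
    refine (Metric.dist_le_diam_of_mem hΩc.isBounded hp hr).trans ?_
    rw [hΩ, convexHull_diam]
    refine Metric.diam_le_of_forall_dist_le hL0 ?_
    rintro _ ⟨i, rfl⟩ _ ⟨j, rfl⟩
    exact hq_dist i j
  have hmain := setIntegral_norm_sq_le_pdv hΩc hΩconv hdiam (hu.of_le (mod_cast le_top)) hu_bd
  have hexp : 1 ≤ Real.sqrt (Real.exp 1 - 1) := by
    rw [Real.one_le_sqrt]
    linarith [Real.add_one_le_exp (1 : ℝ)]
  calc Real.sqrt (∫ x in Ω, ‖u x‖ ^ 2)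
      ≤ Real.sqrt (L ^ 2 * ∫ x in Ω, ‖pdv (0 : Fin 2) u x‖ ^ 2) := Real.sqrt_le_sqrt hmain
    _ = L * 1 * Real.sqrt (∫ x in Ω, ‖pdv (0 : Fin 2) u x‖ ^ 2) := by
        rw [Real.sqrt_mul (sq_nonneg L), Real.sqrt_sq hL0, mul_one]
    _ ≤ _ := by gcongr
end
end

section
/- Fix an integer n > 0, let Ω = [0,2π]², and let u(x,y,t) = (1/π) e^{−it(1+n²)} sin(x) sin(ny). Then for every T > 0 the Neumann data on the right edge {2π} × [0,2π] satisfies ∫₀ᵀ ∫₀^{2π} |∂ₓu(2π, y, t)|² dy dt = T/π = (T/(π(1+n²))) E(0), where E(0) = 1+n² is the energy of u. -/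
open MeasureTheory

noncomputable section

/-- The integral of `sin² (n y)` over a full period is `π` for every positive integer `n`. -/
theorem integral_sin_nat_mul_sq (n : ℕ) (hn : 0 < n) :
    ∫ y in (0:ℝ)..(2 * Real.pi), Real.sin (n * y) ^ 2 = Real.pi := by
  have hn' : (n : ℝ) ≠ 0 := by positivity
  have h : Real.sin (n * (2 * Real.pi)) = 0 := by
    simpa using Real.sin_periodic.nat_mul_eq n
  rw [intervalIntegral.integral_comp_mul_left (fun y => Real.sin y ^ 2) hn', integral_sin_sq, h]
  simp only [mul_zero, Real.sin_zero, zero_mul, smul_eq_mul]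
  field_simp
  ring

/-- The `x`-derivative of `a sin x · b` at `2π` is `a b`. -/
theorem deriv_mul_sin_mul_two_pi (a b : ℂ) :
    deriv (fun x : ℝ => a * Complex.sin (x : ℂ) * b) (2 * Real.pi) = a * b := by
  have h : HasDerivAt (fun x : ℝ => a * Complex.sin (x : ℂ) * b)
      (a * Complex.cos ((2 * Real.pi : ℝ) : ℂ) * b) (2 * Real.pi) :=
    (((Complex.hasDerivAt_sin _).comp_ofReal).const_mul a).mul_const b
  rw [h.deriv]
  simp

/-- The squared modulus of `π⁻¹ e^{−it(1+n²)} sin (ny)`. -/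
theorem norm_sq_inv_pi_mul_exp_mul_sin (n : ℕ) (y t : ℝ) :
    ‖(Real.pi : ℂ)⁻¹ * Complex.exp (-Complex.I * (t : ℂ) * (1 + (n : ℂ) ^ 2))
      * Complex.sin ((n : ℂ) * (y : ℂ))‖ ^ 2 = (Real.pi ^ 2)⁻¹ * Real.sin (n * y) ^ 2 := by
  have hexp : ‖Complex.exp (-Complex.I * (t : ℂ) * (1 + (n : ℂ) ^ 2))‖ = 1 := by
    rw [← Complex.norm_exp_ofReal_mul_I (-(t * (1 + (n : ℝ) ^ 2)))]
    congr 2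
    push_cast
    ring
  have hsin : Complex.sin ((n : ℂ) * (y : ℂ)) = ((Real.sin (n * y) : ℝ) : ℂ) := by
    push_cast
    rfl
  rw [norm_mul, norm_mul, hexp, hsin, norm_inv, Complex.norm_real, Complex.norm_real, mul_one,
    mul_pow, inv_pow, Real.norm_eq_abs, Real.norm_eq_abs, sq_abs, sq_abs]

/-- **Neumann data of the explicit solution on the right edge of the square.**
For an integer `n > 0` and `u(x,y,t) = (1/π) e^{−it(1+n²)} sin x sin (ny)` on
`Ω = [0,2π]²`, for every `T > 0` the Neumann data on the right edge `{2π} × [0,2π]`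
satisfies `∫₀ᵀ∫₀^{2π} |∂ₓu(2π,y,t)|² dy dt = T/π = (T/(π(1+n²))) E(0)`, where
`E(0) = 1 + n²` is the energy of `u`. -/
theorem explicit_square_neumann_data
    (n : ℕ) (hn : 0 < n)
    (u : ℝ → ℝ → ℝ → ℂ)
    (hu : u = fun (x y t : ℝ) => (Real.pi : ℂ)⁻¹
      * Complex.exp (-Complex.I * (t : ℂ) * (1 + (n : ℂ) ^ 2))
      * Complex.sin (x : ℂ) * Complex.sin ((n : ℂ) * (y : ℂ))) :
    ∀ T > 0,
      (∫ t in (0:ℝ)..T, ∫ y in (0:ℝ)..(2 * Real.pi),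
          ‖deriv (fun v => u v y t) (2 * Real.pi)‖ ^ 2)
        = T / Real.pi
      ∧ (∫ t in (0:ℝ)..T, ∫ y in (0:ℝ)..(2 * Real.pi),
          ‖deriv (fun v => u v y t) (2 * Real.pi)‖ ^ 2)
        = T / (Real.pi * (1 + (n : ℝ) ^ 2)) * (1 + (n : ℝ) ^ 2) := by
  intro T _
  have hpi := Real.pi_ne_zero
  have hmain : (∫ t in (0:ℝ)..T, ∫ y in (0:ℝ)..(2 * Real.pi),
      ‖deriv (fun v => u v y t) (2 * Real.pi)‖ ^ 2) = T / Real.pi := by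
    simp only [hu, deriv_mul_sin_mul_two_pi, norm_sq_inv_pi_mul_exp_mul_sin,
      intervalIntegral.integral_const_mul, integral_sin_nat_mul_sq n hn,
      intervalIntegral.integral_const, sub_zero, smul_eq_mul]
    field_simp
  refine ⟨hmain, hmain.trans ?_⟩
  have hE : 1 + (n : ℝ) ^ 2 ≠ 0 := by positivity
  field_simp
end
end
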